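/- Let T, K > 0 and let u₀(x) = −x^{−1/2} for x > 0 and u₀(x) = 0 for x ≤ 0 (so that x·u₀(x)² = 1 for all x > 0). Then there is no measurable function u : ℝ × (0,T) → ℝ satisfying all of the following: (i) u ∈ L¹_loc(ℝ × (0,T)); (ii) |x·u(x,t)²| ≤ 1 for a.e. (x,t) ∈ ℝ × (0,T); (iii) u(x,t) = −x^{−1/2} for a.e. x > K and a.e. t ∈ (0,T); (iv) u is a weak solution of u_t + (x u²)_x = 0 on ℝ × (0,T) with initial datum u₀. That is, no weak solution with uniformly flux-bounded values (‖x u²‖_{L∞} ≤ 1) and the stationary far-field profile exists for this Cauchy problem. -/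

import Mathlib

open MeasureTheory Set Filter

/-- `u` is a weak solution of `u_t + (x u²)_x = 0` on `ℝ × (0,T)` with initial datum `u₀`:
`u` and the flux `x u²` are locally integrable on the strip, and the integral identity holds
for every smooth compactly supported test function with support in `ℝ × (−∞,T)`.
Points of `ℝ × ℝ` are written `(x, t)`. -/
def IsWeakSolution (T : ℝ) (u : ℝ × ℝ → ℝ) (u₀ : ℝ → ℝ) : Prop :=
  LocallyIntegrableOn u (univ ×ˢ Ioo 0 T) volume ∧
  LocallyIntegrableOn (fun p => p.1 * (u p) ^ 2) (univ ×ˢ Ioo 0 T) volume ∧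
  ∀ φ : ℝ × ℝ → ℝ, ContDiff ℝ (⊤ : ℕ∞) φ → HasCompactSupport φ →
    tsupport φ ⊆ univ ×ˢ Iio T →
    (∫ t in Ioo (0 : ℝ) T, ∫ x : ℝ,
        (u (x, t) * fderiv ℝ φ (x, t) (0, 1)
          + x * (u (x, t)) ^ 2 * fderiv ℝ φ (x, t) (1, 0)))
      + ∫ x : ℝ, u₀ x * φ (x, 0) = 0


/-- spatial cutoff -/
lemma exists_psi (ε K : ℝ) (hε : 0 < ε) (hK : 0 < K) : ∃ ψ : ℝ → ℝ,
    ContDiff ℝ (⊤ : ℕ∞) ψ ∧ (∀ x, 0 ≤ ψ x) ∧ (∀ x, ψ x ≤ 1) ∧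
    (∀ x, x ∉ Icc (-ε) (K + 2) → ψ x = 0) ∧ ψ K = 1 ∧ ψ (K + 2) = 0 ∧
    (∀ x < 0, 0 ≤ deriv ψ x) ∧ (∀ x, 0 < x → x ≤ K → deriv ψ x = 0) ∧
    (∀ x, K + 2 < x → deriv ψ x = 0) := by
  have hA1 : ∀ x : ℝ, 0 ≤ x → Real.smoothTransition ((x + ε) / ε) = 1 := fun x hx =>
    Real.smoothTransition.one_of_one_le (by rw [le_div_iff₀ hε]; linarith)
  have hB1 : ∀ x : ℝ, x ≤ K + 1 → Real.smoothTransition (K + 2 - x) = 1 := fun x hx =>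
    Real.smoothTransition.one_of_one_le (by linarith)
  have hB0 : ∀ x : ℝ, K + 2 ≤ x → Real.smoothTransition (K + 2 - x) = 0 := fun x hx =>
    Real.smoothTransition.zero_of_nonpos (by linarith)
  refine ⟨fun x => Real.smoothTransition ((x + ε) / ε) * Real.smoothTransition (K + 2 - x),
    ?_, ?_, ?_, ?_, ?_, ?_, ?_, ?_, ?_⟩
  · exact (Real.smoothTransition.contDiff.comp (by fun_prop)).mul
      (Real.smoothTransition.contDiff.comp (by fun_prop))
  · exact fun x => mul_nonneg (Real.smoothTransition.nonneg _) (Real.smoothTransition.nonneg _)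
  · exact fun x => mul_le_one₀ (Real.smoothTransition.le_one _) (Real.smoothTransition.nonneg _)
      (Real.smoothTransition.le_one _)
  · intro x hx
    by_cases h : x < -ε
    · have : Real.smoothTransition ((x + ε) / ε) = 0 :=
        Real.smoothTransition.zero_of_nonpos (div_nonpos_of_nonpos_of_nonneg (by linarith) hε.le)
      simp [this]
    · have h2 : K + 2 ≤ x := by
        by_contra h3
        exact hx ⟨by linarith, by linarith⟩
      simp [hB0 x h2]
  · simp only [hA1 K hK.le, hB1 K (by linarith), mul_one]
  · simp only [hB0 (K + 2) le_rfl, mul_zero]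
  · intro x hx
    have he : (fun x => Real.smoothTransition ((x + ε) / ε) * Real.smoothTransition (K + 2 - x))
        =ᶠ[nhds x] (fun x => Real.smoothTransition ((x + ε) / ε)) := by
      filter_upwards [Iio_mem_nhds hx] with y hy
      have hy' : y < 0 := hy
      rw [hB1 y (by linarith), mul_one]
    rw [he.deriv_eq]
    apply Monotone.deriv_nonneg
    intro a b hab
    apply Real.smoothTransition.monotone
    gcongr
  · intro x hx hxK
    have he : (fun x => Real.smoothTransition ((x + ε) / ε) * Real.smoothTransition (K + 2 - x))
        =ᶠ[nhds x] (fun x => (1 : ℝ)) := by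
      filter_upwards [Ioo_mem_nhds hx (show x < K + 1 by linarith)] with y hy
      rw [hB1 y hy.2.le, hA1 y hy.1.le, mul_one]
    rw [he.deriv_eq]
    simp
  · intro x hx
    have he : (fun x => Real.smoothTransition ((x + ε) / ε) * Real.smoothTransition (K + 2 - x))
        =ᶠ[nhds x] (fun x => (0 : ℝ)) := by
      filter_upwards [Ioi_mem_nhds hx] with y hy
      rw [hB0 y (le_of_lt hy), mul_zero]
    rw [he.deriv_eq]
    simp

/-- temporal cutoff -/
lemma exists_theta (T : ℝ) (hT : 0 < T) : ∃ θ : ℝ → ℝ,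
    ContDiff ℝ (⊤ : ℕ∞) θ ∧ (∀ x, 0 ≤ θ x) ∧
    (∀ x, x ∉ Icc (-2) (3 * T / 4) → θ x = 0) ∧ (∀ x, 0 ≤ x → x ≤ T / 2 → θ x = 1) ∧
    θ T = 0 ∧ (∀ x, 0 < x → deriv θ x ≤ 0) := by
  have hA1 : ∀ x : ℝ, -1 ≤ x → Real.smoothTransition (x + 2) = 1 := fun x hx =>
    Real.smoothTransition.one_of_one_le (by linarith)
  have hB1 : ∀ x : ℝ, x ≤ T / 2 → Real.smoothTransition ((3 * T - 4 * x) / T) = 1 := fun x hx =>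
    Real.smoothTransition.one_of_one_le (by rw [le_div_iff₀ hT]; linarith)
  have hB0 : ∀ x : ℝ, 3 * T / 4 ≤ x → Real.smoothTransition ((3 * T - 4 * x) / T) = 0 :=
    fun x hx => Real.smoothTransition.zero_of_nonpos
      (div_nonpos_of_nonpos_of_nonneg (by linarith) hT.le)
  refine ⟨fun x => Real.smoothTransition (x + 2) * Real.smoothTransition ((3 * T - 4 * x) / T),
    ?_, ?_, ?_, ?_, ?_, ?_⟩
  · exact (Real.smoothTransition.contDiff.comp (by fun_prop)).mul
      (Real.smoothTransition.contDiff.comp (by fun_prop))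
  · exact fun x => mul_nonneg (Real.smoothTransition.nonneg _) (Real.smoothTransition.nonneg _)
  · intro x hx
    by_cases h : x < -2
    · have : Real.smoothTransition (x + 2) = 0 :=
        Real.smoothTransition.zero_of_nonpos (by linarith)
      simp [this]
    · have h2 : 3 * T / 4 ≤ x := by
        by_contra h3
        exact hx ⟨by linarith, by linarith⟩
      simp [hB0 x h2]
  · intro x h0 h1
    simp only [hA1 x (by linarith), hB1 x h1, mul_one]
  · simp only [hB0 T (by linarith), mul_zero]
  · intro x hx
    have he : (fun x => Real.smoothTransition (x + 2) * Real.smoothTransition ((3 * T - 4 * x) / T))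
        =ᶠ[nhds x] (fun x => Real.smoothTransition ((3 * T - 4 * x) / T)) := by
      filter_upwards [Ioi_mem_nhds hx] with y hy
      have hy' : 0 < y := hy
      rw [hA1 y (by linarith), one_mul]
    rw [he.deriv_eq]
    apply Antitone.deriv_nonpos
    intro a b hab
    apply Real.smoothTransition.monotone
    gcongr

lemma w_interval (c : ℝ) (hc : 0 ≤ c) :
    IntegrableOn (fun x : ℝ => (Real.sqrt |x|)⁻¹) (Ioc 0 c) ∧
    ∫ x in Ioc 0 c, (Real.sqrt |x|)⁻¹ = 2 * Real.sqrt c := by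
  have he : EqOn (fun x : ℝ => x ^ (-(1/2) : ℝ)) (fun x : ℝ => (Real.sqrt |x|)⁻¹) (Ioc 0 c) := by
    intro x hx
    simp only
    rw [abs_of_pos hx.1, Real.rpow_neg hx.1.le, Real.sqrt_eq_rpow]
  constructor
  · have := (intervalIntegral.intervalIntegrable_rpow' (a := 0) (b := c)
      (r := (-(1/2) : ℝ)) (by norm_num))
    rw [intervalIntegrable_iff_integrableOn_Ioc_of_le hc] at this
    exact this.congr_fun he measurableSet_Ioc
  · rw [← setIntegral_congr_fun measurableSet_Ioc he, ← intervalIntegral.integral_of_le hc,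
      integral_rpow (Or.inl (by norm_num)), Real.sqrt_eq_rpow]
    norm_num
    ring

lemma w_neg (c : ℝ) (hc : 0 ≤ c) :
    IntegrableOn (fun x : ℝ => (Real.sqrt |x|)⁻¹) (Ioc (-c) 0) ∧
    ∫ x in Ioc (-c) 0, (Real.sqrt |x|)⁻¹ = 2 * Real.sqrt c := by
  obtain ⟨h1, h2⟩ := w_interval c hc
  rw [← intervalIntegrable_iff_integrableOn_Ioc_of_le hc] at h1
  rw [← intervalIntegral.integral_of_le hc] at h2
  constructor
  · rw [← intervalIntegrable_iff_integrableOn_Ioc_of_le (by linarith)]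
    have := (IntervalIntegrable.iff_comp_neg (by finiteness)).1 h1
    simpa using this.symm
  · rw [← intervalIntegral.integral_of_le (by linarith), ← h2]
    have := intervalIntegral.integral_comp_neg (a := 0) (b := c)
      (fun x : ℝ => (Real.sqrt |x|)⁻¹)
    simpa using this.symm

/-- for the initial datum `u₀(x) = −x^{−1/2}` for `x > 0`, `0` for `x ≤ 0`,
there is no measurable, locally integrable weak solution of `u_t + (x u²)_x = 0` on
`ℝ × (0,T)` whose flux values satisfy `|x u²| ≤ 1` a.e. and which equals the stationary
far-field profile `−x^{−1/2}` for a.e. `x > K`. -/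
theorem statement3 (T K : ℝ) (hT : 0 < T) (hK : 0 < K)
    (u₀ : ℝ → ℝ) (hu₀ : ∀ x : ℝ, u₀ x = if 0 < x then -(Real.sqrt x)⁻¹ else 0) :
    ¬ ∃ u : ℝ × ℝ → ℝ, Measurable u ∧
      LocallyIntegrableOn u (univ ×ˢ Ioo 0 T) volume ∧
      (∀ᵐ p : ℝ × ℝ, p.2 ∈ Ioo 0 T → |p.1 * (u p) ^ 2| ≤ 1) ∧
      (∀ᵐ p : ℝ × ℝ, K < p.1 → p.2 ∈ Ioo 0 T → u p = -(Real.sqrt p.1)⁻¹) ∧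
      IsWeakSolution T u u₀ := by
  rintro ⟨u, hum, -, hb, hfar, -, -, hw⟩
  set ε : ℝ := (T / 8) ^ 2 with hεdef
  have hε : 0 < ε := by positivity
  obtain ⟨ψ, ψC, ψ0, ψ1, ψs, ψK, ψK2, ψneg, ψmid, ψbig⟩ := exists_psi ε K hε hK
  obtain ⟨θ, θC, θ0, θs, θ1, θT, θneg⟩ := exists_theta T hT
  have ψd : Differentiable ℝ ψ := ψC.differentiable (by simp)
  have θd : Differentiable ℝ θ := θC.differentiable (by simp)
  have dψ_c : Continuous (deriv ψ) := ψC.continuous_deriv (by simp)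
  have dθ_c : Continuous (deriv θ) := θC.continuous_deriv (by simp)
  have ψsup : HasCompactSupport ψ := HasCompactSupport.intro isCompact_Icc ψs
  -- the test function
  have key := hw (fun p => ψ p.1 * θ p.2)
    ((ψC.comp contDiff_fst).mul (θC.comp contDiff_snd))
    (HasCompactSupport.intro (K := Icc (-ε) (K + 2) ×ˢ Icc (-2) (3 * T / 4))
      (isCompact_Icc.prod isCompact_Icc) (by
        intro p hp
        by_cases h : p.1 ∈ Icc (-ε) (K + 2)
        · have : p.2 ∉ Icc (-2) (3 * T / 4) := fun h' => hp ⟨h, h'⟩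
          simp [θs _ this]
        · simp [ψs _ h]))
    (by
      have hsub : tsupport (fun p : ℝ × ℝ => ψ p.1 * θ p.2) ⊆
          univ ×ˢ Icc (-2) (3 * T / 4) := by
        apply closure_minimal _ (isClosed_univ.prod isClosed_Icc)
        intro p hp
        refine ⟨mem_univ _, ?_⟩
        by_contra h
        exact hp (by simp [θs _ h])
      refine hsub.trans (Set.prod_mono le_rfl ?_)
      intro t ht
      have := ht.2
      show t < T
      linarith)
  have hfd : ∀ x t : ℝ, HasFDerivAt (fun p : ℝ × ℝ => ψ p.1 * θ p.2)
      (ψ x • (deriv θ t • ContinuousLinearMap.snd ℝ ℝ ℝ) +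
        θ t • (deriv ψ x • ContinuousLinearMap.fst ℝ ℝ ℝ)) (x, t) := by
    intro x t
    have h1 : HasFDerivAt (fun p : ℝ × ℝ => ψ p.1)
        (deriv ψ x • ContinuousLinearMap.fst ℝ ℝ ℝ) (x, t) :=
      HasDerivAt.comp_hasFDerivAt (h₂ := ψ) (f := Prod.fst) (x, t)
        (ψd x).hasDerivAt hasFDerivAt_fst
    have h2 : HasFDerivAt (fun p : ℝ × ℝ => θ p.2)
        (deriv θ t • ContinuousLinearMap.snd ℝ ℝ ℝ) (x, t) :=
      HasDerivAt.comp_hasFDerivAt (h₂ := θ) (f := Prod.snd) (x, t)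
        (θd t).hasDerivAt hasFDerivAt_snd
    exact h1.mul h2
  have hd1 : ∀ x t : ℝ, fderiv ℝ (fun p : ℝ × ℝ => ψ p.1 * θ p.2) (x, t) (0, 1)
      = ψ x * deriv θ t := by
    intro x t
    rw [(hfd x t).fderiv]
    simp
  have hd2 : ∀ x t : ℝ, fderiv ℝ (fun p : ℝ × ℝ => ψ p.1 * θ p.2) (x, t) (1, 0)
      = deriv ψ x * θ t := by
    intro x t
    rw [(hfd x t).fderiv]
    simp [mul_comm]
  simp only [hd1, hd2] at key
  -- the weight
  set w : ℝ → ℝ := fun x => (Real.sqrt |x|)⁻¹ with hwdef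
  have w0 : ∀ x, 0 ≤ w x := fun x => by positivity
  have wm : Measurable w := by fun_prop
  obtain ⟨wi1, -⟩ := w_interval (K + 2) (by linarith)
  obtain ⟨wi2, wv2⟩ := w_neg ε hε.le
  have wi : IntegrableOn w (Ioc (-ε) (K + 2)) := by
    have := wi2.union wi1
    rwa [Ioc_union_Ioc_eq_Ioc (by linarith) (by linarith)] at this
  have wψm : Measurable (fun x => w x * ψ x) := wm.mul ψd.continuous.measurable
  have wψi : Integrable (fun x => w x * ψ x) := by
    have hi : Integrable ((Icc (-ε) (K + 2)).indicator w) := by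
      rw [integrable_indicator_iff measurableSet_Icc]
      rwa [integrableOn_Icc_iff_integrableOn_Ioc]
    refine hi.mono' wψm.aestronglyMeasurable (Eventually.of_forall fun x => ?_)
    by_cases h : x ∈ Icc (-ε) (K + 2)
    · rw [indicator_of_mem h, Real.norm_of_nonneg (mul_nonneg (w0 x) (ψ0 x))]
      exact mul_le_of_le_one_right (w0 x) (ψ1 x)
    · rw [indicator_of_notMem h, ψs x h]
      simp
  have dψ_i : Integrable (deriv ψ) :=
    dψ_c.integrable_of_hasCompactSupport ψsup.deriv
  have dψ_ind : Integrable ((Ioc K (K + 2)).indicator (deriv ψ)) :=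
    dψ_i.indicator measurableSet_Ioc
  have dψ_int : ∫ x, (Ioc K (K + 2)).indicator (deriv ψ) x = -1 := by
    rw [integral_indicator measurableSet_Ioc, ← intervalIntegral.integral_of_le (by linarith),
      intervalIntegral.integral_deriv_eq_sub (fun x _ => ψd x) (dψ_c.intervalIntegrable _ _),
      ψK, ψK2]
    norm_num
  have swapae : ∀ {p : ℝ × ℝ → Prop}, (∀ᵐ z, p z) → ∀ᵐ t : ℝ, ∀ᵐ x : ℝ, p (x, t) := by
    intro p hp
    have h1 : ∀ᵐ z : ℝ × ℝ, p z.swap := by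
      have := (Measure.measurePreserving_swap (μ := (volume : Measure ℝ))
        (ν := (volume : Measure ℝ))).quasiMeasurePreserving.ae (p := p) hp
      exact this
    exact Measure.ae_ae_of_ae_prod h1
  have hb2 := swapae hb
  have hfar2 := swapae hfar
  -- pointwise bounds
  have hptw : ∀ᵐ t : ℝ, t ∈ Ioo 0 T → ∀ᵐ x : ℝ,
      (u (x, t) * (ψ x * deriv θ t) + x * u (x, t) ^ 2 * (deriv ψ x * θ t)
        ≤ w x * ψ x * (-deriv θ t) + (Ioc K (K + 2)).indicator (deriv ψ) x * θ t) ∧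
      |u (x, t) * (ψ x * deriv θ t) + x * u (x, t) ^ 2 * (deriv ψ x * θ t)|
        ≤ w x * ψ x * |deriv θ t| + |deriv ψ x| * θ t := by
    filter_upwards [hb2, hfar2] with t h1 h2 ht
    have hx0 : ∀ᵐ x : ℝ, x ≠ 0 := by
      simp [ae_iff]
    filter_upwards [h1, h2, hx0] with x g1 g2 g3
    have g1 : |x * u (x, t) ^ 2| ≤ 1 := g1 ht
    have huw : |u (x, t)| ≤ w x := by
      have hax : 0 < |x| := abs_pos.2 g3
      have hs : 0 < Real.sqrt |x| := Real.sqrt_pos.2 hax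
      show |u (x, t)| ≤ (Real.sqrt |x|)⁻¹
      rw [← one_div, le_div_iff₀ hs]
      refine (sq_le_sq₀ (by positivity) zero_le_one).1 ?_
      rw [mul_pow, Real.sq_sqrt hax.le, sq_abs]
      rw [abs_mul, abs_of_nonneg (sq_nonneg (u (x, t)))] at g1
      linarith
    constructor
    · apply add_le_add
      · have : -u (x, t) ≤ w x := (neg_le_abs _).trans huw
        have h3 : 0 ≤ ψ x * (-deriv θ t) :=
          mul_nonneg (ψ0 x) (by linarith [θneg t ht.1])
        nlinarith
      · rw [← mul_assoc]
        apply mul_le_mul_of_nonneg_right _ (θ0 t)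
        rcases lt_or_gt_of_ne g3 with hx | hx
        · rw [indicator_of_notMem (fun h => by have := h.1; linarith)]
          have : x * u (x, t) ^ 2 ≤ 0 := mul_nonpos_of_nonpos_of_nonneg hx.le (sq_nonneg _)
          exact mul_nonpos_of_nonpos_of_nonneg this (ψneg x hx)
        · by_cases hxK : x ≤ K
          · rw [indicator_of_notMem (fun h => by have := h.1; linarith), ψmid x hx hxK]
            simp
          · push Not at hxK
            have : x * u (x, t) ^ 2 = 1 := by
              have g2 : u (x, t) = -(Real.sqrt x)⁻¹ := g2 hxK ht
              rw [g2, neg_sq, inv_pow, Real.sq_sqrt hx.le, mul_inv_cancel₀ g3]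
            rw [this, one_mul]
            by_cases hx2 : x ≤ K + 2
            · rw [indicator_of_mem (show x ∈ Ioc K (K + 2) from ⟨hxK, hx2⟩)]
            · push Not at hx2
              rw [ψbig x hx2, indicator_of_notMem (fun h => by have := h.2; linarith)]
    · refine (abs_add_le _ _).trans (add_le_add ?_ ?_)
      · rw [abs_mul, abs_mul, abs_of_nonneg (ψ0 x), ← mul_assoc]
        have := ψ0 x
        gcongr
      · rw [abs_mul, abs_mul (deriv ψ x), abs_of_nonneg (θ0 t)]
        apply mul_le_of_le_one_left _ g1
        exact mul_nonneg (abs_nonneg _) (θ0 t)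
  have Gm : Measurable (fun p : ℝ × ℝ => u p * (ψ p.1 * deriv θ p.2)
      + p.1 * u p ^ 2 * (deriv ψ p.1 * θ p.2)) := by
    have m1 := ψd.continuous.measurable
    have m2 := θd.continuous.measurable
    have m3 := dψ_c.measurable
    have m4 := dθ_c.measurable
    fun_prop
  set P : ℝ := ∫ x, w x * ψ x with hP
  set Q : ℝ := ∫ x, |deriv ψ x| with hQ
  set F : ℝ → ℝ := fun t => ∫ x, (u (x, t) * (ψ x * deriv θ t)
    + x * u (x, t) ^ 2 * (deriv ψ x * θ t)) with hF
  have Fm : StronglyMeasurable F := Gm.stronglyMeasurable.integral_prod_left'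
  have hFb : ∀ᵐ t : ℝ, t ∈ Ioo 0 T →
      F t ≤ P * (-deriv θ t) + (-1) * θ t ∧ ‖F t‖ ≤ P * |deriv θ t| + Q * θ t := by
    filter_upwards [hptw] with t h ht
    have h := h ht
    have hi2 : Integrable (fun x => w x * ψ x * |deriv θ t| + |deriv ψ x| * θ t) :=
      (wψi.mul_const _).add (dψ_i.abs.mul_const _)
    have hi1 : Integrable (fun x => w x * ψ x * (-deriv θ t)
        + (Ioc K (K + 2)).indicator (deriv ψ) x * θ t) :=
      (wψi.mul_const _).add (dψ_ind.mul_const _)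
    have hiG : Integrable (fun x => u (x, t) * (ψ x * deriv θ t)
        + x * u (x, t) ^ 2 * (deriv ψ x * θ t)) :=
      hi2.mono' (Gm.comp (measurable_id.prodMk measurable_const)).aestronglyMeasurable
        (h.mono fun x hx => hx.2)
    constructor
    · refine (integral_mono_ae hiG hi1 (h.mono fun x hx => hx.1)).trans_eq ?_
      rw [integral_add (wψi.mul_const _) (dψ_ind.mul_const _), integral_mul_const,
        integral_mul_const, dψ_int]
    · refine (norm_integral_le_of_norm_le hi2 (h.mono fun x hx => hx.2)).trans_eq ?_
      rw [integral_add (wψi.mul_const _) (dψ_i.abs.mul_const _), integral_mul_const,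
        integral_mul_const]
  have cont_int : ∀ {g : ℝ → ℝ}, Continuous g → IntegrableOn g (Ioo 0 T) := by
    intro g hg
    exact (hg.continuousOn.integrableOn_compact isCompact_Icc).mono_set Ioo_subset_Icc_self
  have hFb2 := (ae_restrict_iff' (measurableSet_Ioo (a := (0 : ℝ)) (b := T))).2 hFb
  have Fi : IntegrableOn F (Ioo 0 T) := by
    have : IntegrableOn (fun t => P * |deriv θ t| + Q * θ t) (Ioo 0 T) :=
      cont_int (by have := θd.continuous; fun_prop)
    exact this.mono' Fm.aestronglyMeasurable (hFb2.mono fun t ht => ht.2)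
  have i1 : IntegrableOn (fun t => P * (-deriv θ t)) (Ioo 0 T) := cont_int (by fun_prop)
  have i2 : IntegrableOn (fun t => (-1) * θ t) (Ioo 0 T) :=
    cont_int (by have := θd.continuous; fun_prop)
  have Fle : ∫ t in Ioo 0 T, F t ≤ P - T / 2 := by
    have h1 : ∫ t in Ioo 0 T, F t ≤ ∫ t in Ioo 0 T, (P * (-deriv θ t) + (-1) * θ t) :=
      integral_mono_ae Fi (i1.add i2) (hFb2.mono fun t ht => ht.1)
    have h2 : ∫ t in Ioo 0 T, deriv θ t = -1 := by
      rw [← integral_Ioc_eq_integral_Ioo, ← intervalIntegral.integral_of_le hT.le,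
        intervalIntegral.integral_deriv_eq_sub (fun x _ => θd x) (dθ_c.intervalIntegrable _ _),
        θT, θ1 0 le_rfl (by linarith)]
      norm_num
    have h3 : T / 2 ≤ ∫ t in Ioo 0 T, θ t := by
      have h4 : ∫ t in Ioo 0 (T / 2), θ t ≤ ∫ t in Ioo 0 T, θ t :=
        setIntegral_mono_set (cont_int θd.continuous)
          (Eventually.of_forall fun t => θ0 t)
          (Ioo_subset_Ioo_right (by linarith)).eventuallyLE
      have h5 : ∫ t in Ioo 0 (T / 2), θ t = ∫ t in Ioo 0 (T / 2), (1 : ℝ) :=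
        setIntegral_congr_fun measurableSet_Ioo fun t ht => θ1 t ht.1.le ht.2.le
      rw [h5] at h4
      simp at h4
      exact h4.1
    rw [integral_add i1 i2, integral_const_mul, integral_const_mul, integral_neg, h2] at h1
    linarith
  -- the initial datum
  have hdatum : P + ∫ x, u₀ x * (ψ x * θ 0) ≤ 2 * Real.sqrt ε := by
    have hθ : θ 0 = 1 := θ1 0 le_rfl (by linarith)
    have hu : ∀ x, u₀ x * (ψ x * θ 0) = -((Ioi (0 : ℝ)).indicator (fun x => w x * ψ x) x) := by
      intro x
      rw [hu₀, hθ, mul_one]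
      by_cases h : 0 < x
      · rw [if_pos h, indicator_of_mem (show x ∈ Ioi 0 from h), hwdef]
        simp only [abs_of_pos h]
        ring
      · rw [if_neg h, indicator_of_notMem (show x ∉ Ioi 0 from h)]
        simp
    simp_rw [hu]
    rw [integral_neg, integral_indicator measurableSet_Ioi, hP,
      ← integral_add_compl (measurableSet_Ioi (a := (0 : ℝ))) wψi, ← wv2]
    have : ∫ x in (Ioi (0 : ℝ))ᶜ, w x * ψ x ≤ ∫ x in Ioc (-ε) 0, w x := by
      rw [← integral_indicator measurableSet_Ioi.compl, ← integral_indicator measurableSet_Ioc]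
      have hae : ∀ᵐ x : ℝ, x ≠ -ε := by simp [ae_iff]
      apply integral_mono_ae (wψi.indicator measurableSet_Ioi.compl)
        ((integrable_indicator_iff measurableSet_Ioc).2 wi2)
      filter_upwards [hae] with x hx
      by_cases h : x ∈ Ioc (-ε) 0
      · rw [indicator_of_mem h, indicator_of_mem (by simpa using h.2)]
        exact mul_le_of_le_one_right (w0 x) (ψ1 x)
      · rw [indicator_of_notMem h]
        by_cases h' : x ∈ (Ioi (0 : ℝ))ᶜ
        · rw [indicator_of_mem h', ψs x, mul_zero]
          intro h2
          exact h ⟨lt_of_le_of_ne h2.1 (Ne.symm hx), by simpa using h'⟩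
        · rw [indicator_of_notMem h']
    linarith
  have hsq : Real.sqrt ε = T / 8 := Real.sqrt_sq (by positivity)
  rw [hsq] at hdatum
  linarith
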